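/- Let β₂₀, β₂₂ ∈ K be such that the plane sextic C : X⁶ + Y⁵Z + YZ⁵ + β₂₀X²(Z⁴ − Y⁴) + β₂₂X²Y²Z² = 0 is smooth and such that every element of Aut(C) ⊂ PGL₃(K) has order at most 4. Then Aut(C) equals the subgroup generated by σ = diag(1, ζ₄, ζ₄⁻¹) and σ′ = [X : ζ₈Z : −ζ₈⁻¹Y], and Aut(C) is isomorphic to the quaternion group Q₈ of order 8. -/

import Mathlib

open MvPolynomial

/-- `GL₃(K)`: the group of invertible `3 × 3` matrices over `K`. -/
abbrev GL3 (K : Type*) [Field K] := (Matrix (Fin 3) (Fin 3) K)ˣ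

/-- `PGL₃(K)`: the quotient of `GL₃(K)` by its center (the scalar matrices). -/
abbrev PGL3 (K : Type*) [Field K] := GL3 K ⧸ Subgroup.center (GL3 K)

variable {K : Type*} [Field K]

/-- The substitution `F(X,Y,Z) ↦ F(A·(X,Y,Z)ᵗ)` for a `3 × 3` matrix `A`. -/
noncomputable def matAct (A : Matrix (Fin 3) (Fin 3) K) (F : MvPolynomial (Fin 3) K) :
    MvPolynomial (Fin 3) K :=
  aeval (fun i => ∑ j, C (A i j) * X j) F

lemma matAct_one (F : MvPolynomial (Fin 3) K) : matAct 1 F = F := by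
  unfold matAct
  have h : (fun i => ∑ j, C ((1 : Matrix (Fin 3) (Fin 3) K) i j) * X j)
      = (X : Fin 3 → MvPolynomial (Fin 3) K) := by
    funext i
    rw [Finset.sum_eq_single i]
    · simp
    · intro b _ hb
      simp [Matrix.one_apply, Ne.symm hb]
    · simp
  rw [h, aeval_X_left_apply]

lemma matAct_matAct (A B : Matrix (Fin 3) (Fin 3) K) (F : MvPolynomial (Fin 3) K) :
    matAct B (matAct A F) = matAct (A * B) F := by
  unfold matAct
  rw [← AlgHom.comp_apply, comp_aeval]
  have h : (fun i => (aeval fun i => ∑ j, C (B i j) * X j) (∑ j, C (A i j) * X j))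
      = fun i => ∑ j : Fin 3, C ((A * B) i j) * (X j : MvPolynomial (Fin 3) K) := by
    funext i
    simp only [map_sum, map_mul, aeval_C, aeval_X, algebraMap_eq, Finset.mul_sum]
    rw [Finset.sum_comm]
    refine Finset.sum_congr rfl fun k _ => ?_
    rw [Matrix.mul_apply, map_sum, Finset.sum_mul]
    refine Finset.sum_congr rfl fun j _ => ?_
    rw [map_mul, mul_assoc]
  rw [h]

lemma matAct_smul (A : Matrix (Fin 3) (Fin 3) K) (c : K) (F : MvPolynomial (Fin 3) K) :
    matAct A (c • F) = c • matAct A F :=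
  map_smul (aeval fun i => ∑ j, C (A i j) * X j) c F

/-- The class of a matrix `A` in `PGL₃(K)` (junk value `1` if `A` is not invertible). -/
noncomputable def pgl (A : Matrix (Fin 3) (Fin 3) K) : PGL3 K := by
  classical
  exact if h : IsUnit A then (QuotientGroup.mk h.unit : PGL3 K) else 1

/-- `F` defines a smooth plane sextic: `F` is homogeneous of degree `6`, and `F` together with
its partial derivatives have no common zero besides the origin. -/
def IsSmoothSextic (F : MvPolynomial (Fin 3) K) : Prop :=
  F.IsHomogeneous 6 ∧
    ∀ p : Fin 3 → K, eval p F = 0 → (∀ i, eval p (pderiv i F) = 0) → p = 0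

/-- The automorphism group of the plane curve `F = 0`: the subgroup of `PGL₃(K)` consisting of
the classes of matrices `A ∈ GL₃(K)` with `F(A·(X,Y,Z)ᵗ) = λ·F(X,Y,Z)` for some `λ ∈ K×`. -/
noncomputable def planeAut (F : MvPolynomial (Fin 3) K) : Subgroup (PGL3 K) where
  carrier := {g | ∃ A : GL3 K, (QuotientGroup.mk A : PGL3 K) = g ∧
    ∃ c : K, c ≠ 0 ∧ matAct (A : Matrix (Fin 3) (Fin 3) K) F = c • F}
  one_mem' := ⟨1, rfl, 1, one_ne_zero, by rw [Units.val_one, matAct_one, one_smul]⟩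
  mul_mem' := by
    rintro g h ⟨A, rfl, c, hc, hA⟩ ⟨B, rfl, d, hd, hB⟩
    exact ⟨A * B, rfl, c * d, mul_ne_zero hc hd, by
      rw [Units.val_mul, ← matAct_matAct, hA, matAct_smul, hB, smul_smul]⟩
  inv_mem' := by
    rintro g ⟨A, rfl, c, hc, hA⟩
    refine ⟨A⁻¹, rfl, c⁻¹, inv_ne_zero hc, ?_⟩
    rw [eq_inv_smul_iff₀ hc, ← matAct_smul, ← hA, matAct_matAct, ← Units.val_mul,
      mul_inv_cancel, Units.val_one, matAct_one]

theorem binary_coeff_eq_zero [CharZero K] {c₀ c₁ c₂ c₃ c₄ c₅ c₆ : K}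
    (h : ∀ t : K, c₀ + c₁ * t + c₂ * t ^ 2 + c₃ * t ^ 3 + c₄ * t ^ 4 + c₅ * t ^ 5
      + c₆ * t ^ 6 = 0) :
    c₀ = 0 ∧ c₁ = 0 ∧ c₂ = 0 ∧ c₃ = 0 ∧ c₄ = 0 ∧ c₅ = 0 ∧ c₆ = 0 := by
  let p : Polynomial K := .C c₀ + .C c₁ * .X + .C c₂ * .X ^ 2 + .C c₃ * .X ^ 3 + .C c₄ * .X ^ 4
    + .C c₅ * .X ^ 5 + .C c₆ * .X ^ 6
  have hp : p = 0 := Polynomial.funext fun t => by simpa [p] using h t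
  have hc (n : ℕ) : p.coeff n = 0 := by rw [hp, Polynomial.coeff_zero]
  refine ⟨?_, ?_, ?_, ?_, ?_, ?_, ?_⟩
  · simpa [p, Polynomial.coeff_X, Polynomial.coeff_C, Polynomial.coeff_X_pow] using hc 0
  · simpa [p, Polynomial.coeff_X, Polynomial.coeff_C, Polynomial.coeff_X_pow] using hc 1
  · simpa [p, Polynomial.coeff_X, Polynomial.coeff_C, Polynomial.coeff_X_pow] using hc 2
  · simpa [p, Polynomial.coeff_X, Polynomial.coeff_C, Polynomial.coeff_X_pow] using hc 3
  · simpa [p, Polynomial.coeff_X, Polynomial.coeff_C, Polynomial.coeff_X_pow] using hc 4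
  · simpa [p, Polynomial.coeff_X, Polynomial.coeff_C, Polynomial.coeff_X_pow] using hc 5
  · simpa [p, Polynomial.coeff_X, Polynomial.coeff_C, Polynomial.coeff_X_pow] using hc 6

/-- If the third polar of the sextic form at `(x, y, z)` is the cube of the linear form with
coefficients `a, b, c` (up to the scalar `κ`), then either the point is `(1 : 0 : 0)` or
`γ ^ 2 = 12 * β ^ 2`. -/
theorem rank_one_third_polar [CharZero K] {β γ x y z κ a b c : K}
    (hv : x ≠ 0 ∨ y ≠ 0 ∨ z ≠ 0)
    (h000 : 120 * x ^ 3 = κ * a ^ 3)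
    (h001 : 2 * (-4 * β * y ^ 3 + 2 * γ * y * z ^ 2) = κ * a ^ 2 * b)
    (h002 : 2 * (4 * β * z ^ 3 + 2 * γ * y ^ 2 * z) = κ * a ^ 2 * c)
    (h011 : 2 * x * (-12 * β * y ^ 2 + 2 * γ * z ^ 2) = κ * a * b ^ 2)
    (h012 : 2 * x * (4 * γ * y * z) = κ * a * b * c)
    (h022 : 2 * x * (12 * β * z ^ 2 + 2 * γ * y ^ 2) = κ * a * c ^ 2)
    (h111 : x ^ 2 * (-24 * β * y) + 60 * y ^ 2 * z = κ * b ^ 3)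
    (h112 : x ^ 2 * (4 * γ * z) + 20 * y ^ 3 = κ * b ^ 2 * c)
    (h122 : x ^ 2 * (4 * γ * y) + 20 * z ^ 3 = κ * b * c ^ 2)
    (h222 : x ^ 2 * (24 * β * z) + 60 * y * z ^ 2 = κ * c ^ 3) :
    (y = 0 ∧ z = 0 ∧ x ≠ 0) ∨ γ ^ 2 = 12 * β ^ 2 := by
  by_cases hx : x = 0
  · exfalso
    subst hx
    have e1 : y ^ 2 * (3 * z ^ 4 - y ^ 4) = 0 := by
      linear_combination (1 / 400) * (20 * z ^ 3 * h111 + κ * b ^ 3 * h122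
        - 20 * y ^ 3 * h112 - κ * b ^ 2 * c * h112)
    have e2 : z ^ 2 * (3 * y ^ 4 - z ^ 4) = 0 := by
      linear_combination (1 / 400) * (20 * y ^ 3 * h222 + κ * c ^ 3 * h112
        - 20 * z ^ 3 * h122 - κ * c ^ 2 * b * h122)
    have hy : y = 0 := by
      by_contra hy
      have e1' := (mul_eq_zero.1 e1).resolve_left (pow_ne_zero 2 hy)
      rcases mul_eq_zero.1 e2 with h | h
      · have hz : z = 0 := pow_eq_zero_iff (two_ne_zero) |>.1 h
        subst hz
        exact hy (pow_eq_zero_iff (four_ne_zero) |>.1 (by linear_combination -e1'))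
      · exact hy (pow_eq_zero_iff (four_ne_zero) |>.1
          (by linear_combination (1 / 8) * e1' + (3 / 8) * h))
    subst hy
    have hz : z = 0 := pow_eq_zero_iff (n := 6) (by norm_num) |>.1 (by linear_combination -e2)
    simp_all
  have ha : a ≠ 0 := by
    rintro rfl
    exact hx (pow_eq_zero_iff (n := 3) (by norm_num) |>.1 (by linear_combination h000 / 120))
  obtain ⟨r, hr⟩ : ∃ r, r * a = x := ⟨x / a, div_mul_cancel₀ _ ha⟩
  obtain ⟨u, hu⟩ : ∃ u, u = r * b := ⟨_, rfl⟩
  obtain ⟨v, hv'⟩ : ∃ v, v = r * c := ⟨_, rfl⟩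
  have hκ : κ = 120 * r ^ 3 := by
    apply mul_right_cancel₀ (pow_ne_zero 3 ha)
    rw [← h000, ← hr]; ring
  subst hκ
  have q1 : -4 * β * y ^ 3 + 2 * γ * y * z ^ 2 = 60 * x ^ 2 * u := by
    rw [hu, ← hr]; linear_combination h001 / 2
  have q2 : 4 * β * z ^ 3 + 2 * γ * y ^ 2 * z = 60 * x ^ 2 * v := by
    rw [hv', ← hr]; linear_combination h002 / 2
  have q11 : -12 * β * y ^ 2 + 2 * γ * z ^ 2 = 60 * u ^ 2 := by
    apply mul_left_cancel₀ hx
    rw [hu]; rw [← hr] at h011 ⊢; linear_combination h011 / 2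
  have q12 : 4 * γ * y * z = 60 * u * v := by
    apply mul_left_cancel₀ hx
    rw [hu, hv']; rw [← hr] at h012 ⊢; linear_combination h012 / 2
  have q22 : 12 * β * z ^ 2 + 2 * γ * y ^ 2 = 60 * v ^ 2 := by
    apply mul_left_cancel₀ hx
    rw [hv']; rw [← hr] at h022 ⊢; linear_combination h022 / 2
  have p111 : x ^ 2 * (-24 * β * y) + 60 * y ^ 2 * z = 120 * u ^ 3 := by
    rw [hu]; linear_combination h111
  have p112 : x ^ 2 * (4 * γ * z) + 20 * y ^ 3 = 120 * u ^ 2 * v := by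
    rw [hu, hv']; linear_combination h112
  have p122 : x ^ 2 * (4 * γ * y) + 20 * z ^ 3 = 120 * u * v ^ 2 := by
    rw [hu, hv']; linear_combination h122
  have p222 : x ^ 2 * (24 * β * z) + 60 * y * z ^ 2 = 120 * v ^ 3 := by
    rw [hv']; linear_combination h222
  have e1 : u * (u * y + v * z - 3 * x ^ 2) = 0 := by
    linear_combination (1 / 60) * (3 * q1 - y * q11 - z * q12)
  have e2 : v * (u * y + v * z - 3 * x ^ 2) = 0 := by
    linear_combination (1 / 60) * (3 * q2 - y * q12 - z * q22)
  by_cases huv : u * y + v * z - 3 * x ^ 2 = 0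
  swap
  · left
    have hu0 := (mul_eq_zero.1 e1).resolve_right huv
    have hv0 := (mul_eq_zero.1 e2).resolve_right huv
    clear hu hv'
    subst hu0 hv0
    by_cases hγ : γ = 0
    · subst hγ
      by_cases hβ : β = 0
      · subst hβ
        have hy : y = 0 := pow_eq_zero_iff (n := 3) (by norm_num) |>.1
          (by linear_combination p112 / 20)
        have hz : z = 0 := pow_eq_zero_iff (n := 3) (by norm_num) |>.1
          (by linear_combination p122 / 20)
        exact ⟨hy, hz, hx⟩
      · have hy : y = 0 := by simpa [hβ] using q11
        have hz : z = 0 := by simpa [hβ] using q22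
        exact ⟨hy, hz, hx⟩
    · have hyz : y = 0 ∨ z = 0 := by simpa [hγ] using q12
      rcases hyz with rfl | rfl
      · exact ⟨rfl, by simpa [hγ] using q11, hx⟩
      · exact ⟨by simpa [hγ] using q22, rfl, hx⟩
  right
  have r11 : 20 * y ^ 3 * z = 60 * x ^ 2 * u ^ 2 := by
    linear_combination (1 / 4) * (y * p111 + z * p112 - 2 * x ^ 2 * q11 + 120 * u ^ 2 * huv)
  have r12 : 5 * (y ^ 4 + z ^ 4) = 60 * x ^ 2 * u * v := by
    linear_combination (1 / 4) * (y * p112 + z * p122 - 2 * x ^ 2 * q12 + 120 * u * v * huv)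
  have r22 : 20 * y * z ^ 3 = 60 * x ^ 2 * v ^ 2 := by
    linear_combination (1 / 4) * (y * p122 + z * p222 - 2 * x ^ 2 * q22 + 120 * v ^ 2 * huv)
  have s11 : x ^ 2 * (-12 * β * y ^ 2 + 2 * γ * z ^ 2) = 20 * y ^ 3 * z := by
    linear_combination x ^ 2 * q11 - r11
  have s12 : x ^ 2 * (4 * γ * y * z) = 5 * (y ^ 4 + z ^ 4) := by
    linear_combination x ^ 2 * q12 - r12
  have s22 : x ^ 2 * (12 * β * z ^ 2 + 2 * γ * y ^ 2) = 20 * y * z ^ 3 := by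
    linear_combination x ^ 2 * q22 - r22
  have hH : (y ^ 4 + z ^ 4) ^ 2 = 16 * y ^ 4 * z ^ 4 := by
    linear_combination (1 / 25) * (5 * (y ^ 4 + z ^ 4) * r12 + 60 * x ^ 2 * u * v * r12
      - 20 * y ^ 3 * z * r22 - 60 * x ^ 2 * v ^ 2 * r11)
  have hy : y ≠ 0 := by
    rintro rfl
    have hz : z = 0 := pow_eq_zero_iff (n := 8) (by norm_num) |>.1 (by linear_combination hH)
    subst hz
    apply hx
    exact pow_eq_zero_iff (n := 2) (by norm_num) |>.1 (by linear_combination -huv / 3)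
  have hz : z ≠ 0 := by
    rintro rfl
    exact hy (pow_eq_zero_iff (n := 8) (by norm_num) |>.1 (by linear_combination hH))

  have hγ2 : x ^ 4 * γ ^ 2 = 25 * y ^ 2 * z ^ 2 := by
    apply mul_left_cancel₀ (pow_ne_zero 2 (mul_ne_zero hy hz))
    linear_combination (1 / 16) * ((x ^ 2 * (4 * γ * y * z) + 5 * (y ^ 4 + z ^ 4)) * s12 + 25 * hH)
  have hβ2 : 12 * (x ^ 4 * β ^ 2) = 25 * y ^ 2 * z ^ 2 := by
    apply mul_left_cancel₀ (pow_ne_zero 2 (mul_ne_zero hy hz))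
    linear_combination (-1 / 12) * (x ^ 2 * (12 * β * z ^ 2) * s11
      + (20 * y ^ 3 * z - 2 * x ^ 2 * γ * z ^ 2) * s22)
      - (2 / 3) * (x ^ 2 * γ * y * z) * s12 + (7 / 3) * y ^ 2 * z ^ 2 * hγ2
  apply mul_left_cancel₀ (pow_ne_zero 4 hx)
  linear_combination hγ2 - hβ2

theorem pow_mul_eq_mul_inv_pow {G : Type*} [Group G] {s t : G} (hc : t * s = s⁻¹ * t) (k : ℕ) :
    s ^ k * t = t * (s ^ k)⁻¹ := by
  have h : s * t = t * s⁻¹ := by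
    rw [eq_mul_inv_iff_mul_eq, mul_assoc, hc, mul_inv_cancel_left]
  induction k with
  | zero => simp
  | succ k ih => rw [pow_succ, mul_assoc, h, ← mul_assoc, ih, mul_assoc, ← mul_inv_rev, ← pow_succ',
      pow_succ]

theorem quaternionGroup_of_relations {G : Type*} [Group G] (H : Subgroup G) {s t : G}
    (hs : s ∈ H) (ht : t ∈ H) (h4 : s ^ 4 = 1) (h2 : s ^ 2 ≠ 1) (ht2 : t ^ 2 = s ^ 2)
    (hc : t * s = s⁻¹ * t) (hH : ∀ g ∈ H, ∃ k : ℕ, g = s ^ k ∨ g = t * s ^ k) :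
    H = Subgroup.closure {s, t} ∧ Nonempty (H ≃* QuaternionGroup 2) := by
  have hmem (k : ℕ) : s ^ k ∈ H := pow_mem hs k
  constructor
  · apply le_antisymm
    · intro g hg
      have hs' : s ∈ Subgroup.closure {s, t} := Subgroup.subset_closure (by simp)
      have ht' : t ∈ Subgroup.closure {s, t} := Subgroup.subset_closure (by simp)
      obtain ⟨k, rfl | rfl⟩ := hH g hg
      · exact pow_mem hs' k
      · exact mul_mem ht' (pow_mem hs' k)
    · rw [Subgroup.closure_le]
      rintro g (rfl | rfl) <;> assumption
  let e : ZMod (2 * 2) → G := fun i => s ^ i.val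
  have he_add (i j : ZMod (2 * 2)) : e (i + j) = e i * e j := by
    simp only [e]
    rw [ZMod.val_add, ← pow_add]
    exact (pow_eq_pow_mod _ h4).symm
  have he0 : e 0 = 1 := by simp [e]
  have he_neg (i : ZMod (2 * 2)) : e (-i) = (e i)⁻¹ := by
    rw [eq_inv_iff_mul_eq_one, ← he_add, neg_add_cancel, he0]
  have he2 : e ((2 : ℕ) : ZMod (2 * 2)) = s ^ 2 := rfl
  have het (i : ZMod (2 * 2)) : e i * t = t * (e i)⁻¹ := pow_mul_eq_mul_inv_pow hc _
  have hnat (k : ℕ) : e (k : ZMod (2 * 2)) = s ^ k := by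
    simp only [e]
    rw [ZMod.val_natCast]
    exact (pow_eq_pow_mod _ h4).symm
  let f : QuaternionGroup 2 →* G := MonoidHom.mk'
    (fun x => match x with
      | .a i => e i
      | .xa i => t * e i) (by
    rintro (i | i) (j | j)
    · exact he_add i j
    · change t * e (j - i) = e i * (t * e j)
      rw [← mul_assoc, het, sub_eq_neg_add, he_add, he_neg, mul_assoc]
    · change t * e (i + j) = t * e i * e j
      rw [he_add, mul_assoc]
    · change e (((2 : ℕ) : ZMod (2 * 2)) + j - i) = t * e i * (t * e j)
      rw [mul_assoc t, ← mul_assoc (e i), het, add_sub_assoc, he_add, he2, ← ht2, sub_eq_neg_add,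
        he_add, he_neg, pow_two]
      simp only [mul_assoc])
  have hcomm : t * s ≠ s * t := by
    intro h
    rw [hc] at h
    apply h2
    have := mul_right_cancel h
    rw [pow_two]
    nth_rewrite 1 [← this]
    exact inv_mul_cancel s
  have hinj : Function.Injective f := by
    rw [injective_iff_map_eq_one]
    rintro (i | i) h
    · change e i = 1 at h
      have ho : orderOf s = 2 ^ (1 + 1) := orderOf_eq_prime_pow h2 h4
      have hdvd : 2 ^ (1 + 1) ∣ i.val := ho ▸ orderOf_dvd_of_pow_eq_one h
      have hi : i = 0 :=
        (ZMod.val_eq_zero i).1 (Nat.eq_zero_of_dvd_of_lt hdvd (ZMod.val_lt i))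
      rw [hi]
      rfl
    · change t * e i = 1 at h
      exfalso
      apply hcomm
      rw [eq_inv_of_mul_eq_one_left h]
      exact ((Commute.refl s).pow_right _).inv_right.symm.eq
  have hran : f.range = H := by
    ext g
    constructor
    · rintro ⟨i | i, rfl⟩
      · exact hmem _
      · exact mul_mem ht (hmem _)
    · intro hg
      obtain ⟨k, rfl | rfl⟩ := hH g hg
      · exact ⟨.a k, hnat k⟩
      · exact ⟨.xa k, congrArg (t * ·) (hnat k)⟩
  exact ⟨((MonoidHom.ofInjective hinj).trans (MulEquiv.subgroupCongr hran)).symm⟩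

/-- The matrix of a linear map that is the identity on the first coordinate and acts by
`!![s, t; u, v]` on the last two. -/
def blockMatrix (s t u v : K) : Matrix (Fin 3) (Fin 3) K := !![1, 0, 0; 0, s, t; 0, u, v]

theorem blockMatrix_mul (s t u v s' t' u' v' : K) :
    blockMatrix s t u v * blockMatrix s' t' u' v'
      = blockMatrix (s * s' + t * u') (s * t' + t * v') (u * s' + v * u') (u * t' + v * v') := by
  ext i j
  fin_cases i <;> fin_cases j <;> simp [blockMatrix, Matrix.mul_apply, Fin.sum_univ_three]

theorem blockMatrix_one : blockMatrix (1 : K) 0 0 1 = 1 := by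
  ext i j
  fin_cases i <;> fin_cases j <;> simp [blockMatrix]

theorem isUnit_blockMatrix {s t u v : K} (h : s * v - t * u ≠ 0) :
    IsUnit (blockMatrix s t u v) := by
  rw [Matrix.isUnit_iff_isUnit_det, isUnit_iff_ne_zero, blockMatrix, Matrix.det_fin_three]
  simpa using h

theorem pgl_coe (A : GL3 K) : pgl (A : Matrix (Fin 3) (Fin 3) K) = (QuotientGroup.mk A : PGL3 K) := by
  rw [pgl, dif_pos A.isUnit]
  congr 1
  exact Units.ext rfl

theorem pgl_mul {A B : Matrix (Fin 3) (Fin 3) K} (hA : IsUnit A) (hB : IsUnit B) :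
    pgl (A * B) = pgl A * pgl B := by
  obtain ⟨A, rfl⟩ := hA
  obtain ⟨B, rfl⟩ := hB
  rw [← Units.val_mul, pgl_coe, pgl_coe, pgl_coe, QuotientGroup.mk_mul]

theorem pgl_one : pgl (1 : Matrix (Fin 3) (Fin 3) K) = 1 := by
  rw [← Units.val_one, pgl_coe, QuotientGroup.mk_one]

theorem pgl_smul {A : Matrix (Fin 3) (Fin 3) K} (hA : IsUnit A) {c : K} (hc : c ≠ 0) :
    pgl (c • A) = pgl A := by
  have hu : IsUnit (Matrix.scalar (Fin 3) c) := (isUnit_iff_ne_zero.2 hc).map _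
  have h1 : pgl (Matrix.scalar (Fin 3) c) = 1 := by
    obtain ⟨S, hS⟩ := hu
    rw [← hS, pgl_coe, QuotientGroup.eq_one_iff]
    exact Matrix.GeneralLinearGroup.mem_center_iff_val_mem_range_scalar.2 ⟨c, hS.symm⟩
  rw [Matrix.smul_eq_diagonal_mul, ← Matrix.scalar_apply, pgl_mul hu hA, h1, one_mul]

theorem pgl_blockMatrix_mul {s t u v s' t' u' v' : K} (h : s * v - t * u ≠ 0)
    (h' : s' * v' - t' * u' ≠ 0) :
    pgl (blockMatrix s t u v) * pgl (blockMatrix s' t' u' v')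
      = pgl (blockMatrix (s * s' + t * u') (s * t' + t * v') (u * s' + v * u')
          (u * t' + v * v')) := by
  rw [← pgl_mul (isUnit_blockMatrix h) (isUnit_blockMatrix h'), blockMatrix_mul]

theorem pgl_blockMatrix_ne_one {s t u v : K} (h : s * v - t * u ≠ 0) (hne : s ≠ 1 ∨ u ≠ 0) :
    pgl (blockMatrix s t u v) ≠ 1 := by
  obtain ⟨A, hA⟩ := isUnit_blockMatrix h
  rw [← hA, pgl_coe, Ne, QuotientGroup.eq_one_iff,
    Matrix.GeneralLinearGroup.mem_center_iff_val_mem_range_scalar, hA]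
  rintro ⟨c, hc⟩
  have h0 := congrFun (congrFun hc 0) 0
  have h1 := congrFun (congrFun hc 1) 1
  have h2 := congrFun (congrFun hc 2) 1
  simp [blockMatrix] at h0 h1 h2
  rcases hne with hne | hne
  · exact hne (by rw [← h1, h0])
  · exact hne h2.symm

/-- The sextic `X⁶ + Y⁵Z + YZ⁵ + βX²(Z⁴ − Y⁴) + γX²Y²Z²`. -/
noncomputable abbrev quaternionSextic (β γ : K) : MvPolynomial (Fin 3) K :=
  X 0 ^ 6 + X 1 ^ 5 * X 2 + X 1 * X 2 ^ 5 + C β * X 0 ^ 2 * (X 2 ^ 4 - X 1 ^ 4)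
    + C γ * X 0 ^ 2 * X 1 ^ 2 * X 2 ^ 2

theorem eval_quaternionSextic (β γ : K) (w : Fin 3 → K) :
    eval w (quaternionSextic β γ) = w 0 ^ 6 + w 1 ^ 5 * w 2 + w 1 * w 2 ^ 5
      + β * w 0 ^ 2 * (w 2 ^ 4 - w 1 ^ 4) + γ * w 0 ^ 2 * w 1 ^ 2 * w 2 ^ 2 := by
  simp [quaternionSextic]

theorem eval_matAct (A : Matrix (Fin 3) (Fin 3) K) (F : MvPolynomial (Fin 3) K) (w : Fin 3 → K) :
    eval w (matAct A F) = eval (A.mulVec w) F := by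
  rw [matAct, aeval_def, ← coe_eval₂Hom]
  change ((eval w).comp _) F = _
  congr 1
  ext i
  · simp
  · simp [Matrix.mulVec, dotProduct]

theorem pgl_blockMatrix_mem_planeAut [CharZero K] {β γ s t u v : K} (h : s * v - t * u ≠ 0)
    (hp : ∀ y z : K, (s * y + t * z) ^ 5 * (u * y + v * z) + (s * y + t * z) * (u * y + v * z) ^ 5
      = y ^ 5 * z + y * z ^ 5)
    (hq : ∀ y z : K, β * ((u * y + v * z) ^ 4 - (s * y + t * z) ^ 4)
      + γ * (s * y + t * z) ^ 2 * (u * y + v * z) ^ 2 = β * (z ^ 4 - y ^ 4) + γ * y ^ 2 * z ^ 2) :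
    pgl (blockMatrix s t u v) ∈ planeAut (quaternionSextic β γ) := by
  obtain ⟨A, hA⟩ := isUnit_blockMatrix h
  refine ⟨A, by rw [← hA, pgl_coe], 1, one_ne_zero, MvPolynomial.funext fun w => ?_⟩
  rw [hA, eval_matAct, one_smul, eval_quaternionSextic, eval_quaternionSextic]
  simp only [blockMatrix, Matrix.mulVec, dotProduct, Fin.sum_univ_three]
  simp
  linear_combination hp (w 1) (w 2) + w 0 ^ 2 * hq (w 1) (w 2)

/-- If the sextic form `F` satisfies `F(v + tY) = e · F(1 + tL, tM, tN)` for all `t`, then the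
third polar of `F` at `v = (x, y, z)` is the cube `120 e L³`. -/
theorem third_polar_eq [CharZero K] {β γ e x y z Y₀ Y₁ Y₂ L M N : K}
    (h : ∀ t : K, (x + t * Y₀) ^ 6 + (y + t * Y₁) ^ 5 * (z + t * Y₂)
        + (y + t * Y₁) * (z + t * Y₂) ^ 5
        + β * (x + t * Y₀) ^ 2 * ((z + t * Y₂) ^ 4 - (y + t * Y₁) ^ 4)
        + γ * (x + t * Y₀) ^ 2 * (y + t * Y₁) ^ 2 * (z + t * Y₂) ^ 2
      = e * ((1 + t * L) ^ 6 + (t * M) ^ 5 * (t * N) + (t * M) * (t * N) ^ 5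
        + β * (1 + t * L) ^ 2 * ((t * N) ^ 4 - (t * M) ^ 4)
        + γ * (1 + t * L) ^ 2 * (t * M) ^ 2 * (t * N) ^ 2)) :
    120 * x ^ 3 * Y₀ ^ 3
      + 6 * ((4 * β * z ^ 3 + 2 * γ * y ^ 2 * z) * Y₂
        + (-4 * β * y ^ 3 + 2 * γ * y * z ^ 2) * Y₁) * Y₀ ^ 2
      + 6 * x * Y₀ * ((-12 * β * y ^ 2 + 2 * γ * z ^ 2) * Y₁ ^ 2 + 2 * (4 * γ * y * z) * Y₁ * Y₂
        + (12 * β * z ^ 2 + 2 * γ * y ^ 2) * Y₂ ^ 2)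
      + ((x ^ 2 * (-24 * β * y) + 60 * y ^ 2 * z) * Y₁ ^ 3
        + 3 * (x ^ 2 * (4 * γ * z) + 20 * y ^ 3) * Y₁ ^ 2 * Y₂
        + 3 * (x ^ 2 * (4 * γ * y) + 20 * z ^ 3) * Y₁ * Y₂ ^ 2
        + (x ^ 2 * (24 * β * z) + 60 * y * z ^ 2) * Y₂ ^ 3)
      = 120 * e * L ^ 3 := by
  linear_combination 6 * ((-13 / 48) * (h 1 - h (-1)) + (1 / 6) * (h 2 - h (-2))
    + (-1 / 48) * (h 3 - h (-3)))

theorem blockForm_of_form_invariant [CharZero K] {β γ s t u v : K} (hdet : s * v - t * u ≠ 0)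
    (hp : ∀ y z : K, (s * y + t * z) ^ 5 * (u * y + v * z) + (s * y + t * z) * (u * y + v * z) ^ 5
      = y ^ 5 * z + y * z ^ 5)
    (hq : ∀ y z : K, β * ((u * y + v * z) ^ 4 - (s * y + t * z) ^ 4)
      + γ * (s * y + t * z) ^ 2 * (u * y + v * z) ^ 2 = β * (z ^ 4 - y ^ 4) + γ * y ^ 2 * z ^ 2)
    (hβ : β ≠ 0) (h4 : γ ^ 2 ≠ -4 * β ^ 2) (h12 : γ ^ 2 ≠ 12 * β ^ 2) :
    (t = 0 ∧ u = 0 ∧ s ^ 4 = 1 ∧ s * v = 1) ∨ (s = 0 ∧ v = 0 ∧ u ^ 4 = -1 ∧ t * u = -1) := by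
  obtain ⟨c0, c1, -, -, c4, c5, c6⟩ := binary_coeff_eq_zero
    (c₀ := t ^ 5 * v + t * v ^ 5)
    (c₁ := 5 * s * t ^ 4 * v + t ^ 5 * u + 5 * t * u * v ^ 4 + s * v ^ 5 - 1)
    (c₂ := 10 * s ^ 2 * t ^ 3 * v + 5 * s * t ^ 4 * u + 10 * t * u ^ 2 * v ^ 3 + 5 * s * u * v ^ 4)
    (c₃ := 10 * s ^ 3 * t ^ 2 * v + 10 * s ^ 2 * t ^ 3 * u + 10 * t * u ^ 3 * v ^ 2
      + 10 * s * u ^ 2 * v ^ 3)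
    (c₄ := 5 * s ^ 4 * t * v + 10 * s ^ 3 * t ^ 2 * u + 5 * t * u ^ 4 * v + 10 * s * u ^ 3 * v ^ 2)
    (c₅ := s ^ 5 * v + 5 * s ^ 4 * t * u + t * u ^ 5 + 5 * s * u ^ 4 * v - 1)
    (c₆ := s ^ 5 * u + s * u ^ 5) (fun y => by linear_combination hp y 1)
  obtain ⟨-, -, d2, d3, d4, -, -⟩ := binary_coeff_eq_zero
    (c₀ := β * (v ^ 4 - t ^ 4) + γ * t ^ 2 * v ^ 2 - β)
    (c₁ := 4 * β * (u * v ^ 3 - s * t ^ 3) + γ * (2 * s * t * v ^ 2 + 2 * t ^ 2 * u * v))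
    (c₂ := 6 * β * (u ^ 2 * v ^ 2 - s ^ 2 * t ^ 2)
      + γ * (s ^ 2 * v ^ 2 + 4 * s * t * u * v + t ^ 2 * u ^ 2) - γ)
    (c₃ := 4 * β * (u ^ 3 * v - s ^ 3 * t) + γ * (2 * s * t * u ^ 2 + 2 * s ^ 2 * u * v))
    (c₄ := β * (u ^ 4 - s ^ 4) + γ * s ^ 2 * u ^ 2 + β)
    (c₅ := 0) (c₆ := 0) (fun y => by linear_combination hq y 1)
  by_cases hs : s = 0
  · subst hs
    right
    have htu : t ≠ 0 ∧ u ≠ 0 := by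
      constructor <;> (rintro rfl; simp at hdet)
    have hv : v = 0 := by simpa [htu.1, htu.2] using c4
    subst hv
    have hu : u ^ 4 = -1 := by
      apply mul_left_cancel₀ hβ
      linear_combination d4
    exact ⟨rfl, rfl, hu, by linear_combination t * u * hu - c5⟩
  by_cases hu : u = 0
  · subst hu
    left
    have ht : t = 0 := by
      have hv : v ≠ 0 := by rintro rfl; simp at hdet
      simpa [hs, hv] using c4
    have hs4 : s ^ 4 = 1 := by
      apply mul_left_cancel₀ hβ
      linear_combination -d4
    exact ⟨ht, rfl, hs4, by linear_combination c5 - s * v * hs4⟩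
  exfalso
  have hsu : s ^ 4 = -u ^ 4 := by
    apply mul_left_cancel₀ (mul_ne_zero hs hu)
    linear_combination c6
  have ht : t ≠ 0 := by
    rintro rfl
    have hv : v = 0 := by simpa [hs, hu] using c4
    simp [hv] at hdet
  have hv : v ≠ 0 := by
    rintro rfl
    exact ht (by simpa [hs, hu] using c4)
  obtain ⟨ε, rfl⟩ : ∃ ε, s = ε * u := ⟨s / u, (div_mul_cancel₀ _ hu).symm⟩
  obtain ⟨δ, rfl⟩ : ∃ δ, t = δ * v := ⟨t / v, (div_mul_cancel₀ _ hv).symm⟩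
  have hε : ε ^ 4 = -1 := by
    apply mul_left_cancel₀ (pow_ne_zero 4 hu)
    linear_combination hsu
  have hε0 : ε ≠ 0 := by rintro rfl; simp at hs
  have key : (ε + δ) * (2 * β + γ * ε ^ 2) = 0 := by
    apply mul_left_cancel₀ (pow_ne_zero 3 hu)
    apply mul_left_cancel₀ hv
    linear_combination (1 / 2) * ε * d3 + 2 * β * δ * u ^ 3 * v * hε
  rcases mul_eq_zero.1 key with h | h
  swap
  · apply h4
    linear_combination (2 * β - γ * ε ^ 2) * h + γ ^ 2 * hε
  obtain rfl : δ = -ε := by linear_combination h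
  have hw : 64 * (ε ^ 2 * u ^ 2 * v ^ 2) ^ 3 = 1 := by
    have h1 : 8 * ε * u ^ 5 * v = 1 := by
      linear_combination c5 + 4 * ε * u ^ 5 * v * hε
    have h2 : -8 * ε * u * v ^ 5 = 1 := by
      linear_combination c1 - 4 * ε * u * v ^ 5 * hε
    linear_combination (-8 * ε * u * v ^ 5) * h1 + h2
      + 64 * ε ^ 2 * u ^ 6 * v ^ 6 * hε
  have hd : 12 * β * (ε ^ 2 * u ^ 2 * v ^ 2)
      = γ * ε ^ 2 * (1 + 2 * (ε ^ 2 * u ^ 2 * v ^ 2)) := by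
    linear_combination ε ^ 2 * d2 + 6 * ε ^ 2 * β * u ^ 2 * v ^ 2 * hε
  generalize ε ^ 2 * u ^ 2 * v ^ 2 = w at hw hd
  have hfac : (4 * w - 1) * (16 * w ^ 2 + 4 * w + 1) = 0 := by linear_combination hw
  rcases mul_eq_zero.1 hfac with hw | hw
  · obtain rfl : w = 1 / 4 := by linear_combination hw / 4
    have h5 : γ * ε ^ 2 = 2 * β := by linear_combination (-2 / 3) * hd
    apply h4
    linear_combination (-γ * ε ^ 2 - 2 * β) * h5 + γ ^ 2 * hε
  · have hw0 : w ≠ 0 := by rintro rfl; simp at hw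
    apply h12
    apply mul_left_cancel₀ (pow_ne_zero 2 hw0)
    linear_combination (-1 / 12) * (12 * β * w + γ * ε ^ 2 * (1 + 2 * w)) * hd
      + w ^ 2 * γ ^ 2 * hε - (1 / 12) * γ ^ 2 * ε ^ 4 * hw

theorem lt_orderOf_of_pow_four_ne_one {G : Type*} [Group G] {g : G} (h4 : g ^ 4 ≠ 1)
    (h8 : g ^ 8 = 1) : 4 < orderOf g := by
  have : orderOf g = 2 ^ (2 + 1) := orderOf_eq_prime_pow h4 h8
  omega

theorem lt_orderOf_of_pow_six_eq_one {G : Type*} [Group G] {g : G} (h2 : g ^ 2 ≠ 1)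
    (h3 : g ^ 3 ≠ 1) (h6 : g ^ 6 = 1) : 4 < orderOf g := by
  have hd : orderOf g ∣ 6 := orderOf_dvd_of_pow_eq_one h6
  have h2' : ¬orderOf g ∣ 2 := fun h => h2 (orderOf_dvd_iff_pow_eq_one.1 h)
  have h3' : ¬orderOf g ∣ 3 := fun h => h3 (orderOf_dvd_iff_pow_eq_one.1 h)
  have hle := Nat.le_of_dvd (by norm_num) hd
  generalize orderOf g = n at *
  interval_cases n <;> omega

theorem exists_lt_orderOf_of_eq_zero [CharZero K] {ζ : K} (hζ : ζ ^ 4 = -1) (γ : K) :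
    ∃ g ∈ planeAut (quaternionSextic 0 γ), 4 < orderOf g := by
  have hdet : ζ ^ 3 * ζ - 0 * 0 ≠ 0 := by
    rw [show ζ ^ 3 * ζ - 0 * 0 = -1 by linear_combination hζ]
    exact neg_ne_zero.2 one_ne_zero
  refine ⟨pgl (blockMatrix (ζ ^ 3) 0 0 ζ), pgl_blockMatrix_mem_planeAut hdet ?_ ?_, ?_⟩
  · intro y z
    grind
  · intro y z
    grind
  · have h2 : pgl (blockMatrix (ζ ^ 3) 0 0 ζ) ^ 2 = pgl (blockMatrix (-ζ ^ 2) 0 0 (ζ ^ 2)) := by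
      rw [pow_two, pgl_blockMatrix_mul hdet hdet]
      congr 2 <;> grind
    have h4 : pgl (blockMatrix (ζ ^ 3) 0 0 ζ) ^ 4 = pgl (blockMatrix (-1) 0 0 (-1)) := by
      rw [pow_mul _ 2 2, h2, pow_two, pgl_blockMatrix_mul (by grind) (by grind)]
      congr 2 <;> grind
    apply lt_orderOf_of_pow_four_ne_one
    · rw [h4]
      exact pgl_blockMatrix_ne_one (by simp) (.inl (by norm_num))
    · rw [pow_mul _ 4 2, h4, pow_two, pgl_blockMatrix_mul (by simp) (by simp), ← pgl_one,
        ← blockMatrix_one]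
      congr 2 <;> ring

theorem exists_lt_orderOf_of_mul_sq_eq [CharZero K] {ε e β γ : K} (hε : ε ^ 4 = -1)
    (he : 2 * e ^ 2 = -1) (hγ : γ * ε ^ 2 = 2 * β) :
    ∃ g ∈ planeAut (quaternionSextic β γ), 4 < orderOf g := by
  have hdet : e * e - (-ε * e) * (-ε ^ 3 * e) ≠ 0 := by
    rw [show e * e - (-ε * e) * (-ε ^ 3 * e) = -1 by grind]
    exact neg_ne_zero.2 one_ne_zero
  obtain rfl : β = γ * ε ^ 2 / 2 := by linear_combination -hγ / 2
  refine ⟨pgl (blockMatrix e (-ε * e) (-ε ^ 3 * e) e), pgl_blockMatrix_mem_planeAut hdet ?_ ?_, ?_⟩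
  · intro y z
    grind
  · intro y z
    grind
  · have h2 : pgl (blockMatrix e (-ε * e) (-ε ^ 3 * e) e) ^ 2
        = pgl (blockMatrix 0 ε (ε ^ 3) 0) := by
      rw [pow_two, pgl_blockMatrix_mul hdet hdet]
      congr 2 <;> grind
    have h4 : pgl (blockMatrix e (-ε * e) (-ε ^ 3 * e) e) ^ 4
        = pgl (blockMatrix (-1) 0 0 (-1)) := by
      rw [pow_mul _ 2 2, h2, pow_two, pgl_blockMatrix_mul (by grind) (by grind)]
      congr 2 <;> grind
    apply lt_orderOf_of_pow_four_ne_one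
    · rw [h4]
      exact pgl_blockMatrix_ne_one (by simp) (.inl (by norm_num))
    · rw [pow_mul _ 4 2, h4, pow_two, pgl_blockMatrix_mul (by simp) (by simp), ← pgl_one,
        ← blockMatrix_one]
      congr 2 <;> ring

theorem exists_lt_orderOf_of_cube_root [CharZero K] {ζ ω β γ : K} (hζ : ζ ^ 4 = -1)
    (hω : ω ^ 2 + ω + 1 = 0) (hγ : γ = -2 * ζ ^ 2 * (2 * ω + 1) * β) :
    ∃ g ∈ planeAut (quaternionSextic β γ), 4 < orderOf g := by
  obtain ⟨s, hs⟩ : ∃ s, s = ω / 2 * (1 + ζ ^ 2) := ⟨_, rfl⟩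
  obtain ⟨t, ht⟩ : ∃ t, t = ω / 2 * (ζ ^ 3 - ζ) := ⟨_, rfl⟩
  obtain ⟨u, hu⟩ : ∃ u, u = ω / 2 * (ζ - ζ ^ 3) := ⟨_, rfl⟩
  obtain ⟨v, hv⟩ : ∃ v, v = ω / 2 * (1 - ζ ^ 2) := ⟨_, rfl⟩
  have hdet : s * v - t * u = ω ^ 2 := by grind
  have htr : s + v = ω := by grind
  have hω0 : ω ≠ 0 := by rintro rfl; simp at hω
  have hω3 : ω ^ 3 = 1 := by linear_combination (ω - 1) * hω
  have hdet0 : s * v - t * u ≠ 0 := hdet ▸ pow_ne_zero 2 hω0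
  have hu0 : u ≠ 0 := by
    intro h
    have : ω ^ 2 * u ^ 2 = 0 := by simp [h]
    grind
  have hmul (y z : K) : (s * y + t * z) * (u * y + v * z)
      = ω ^ 2 / 2 * ζ * (y ^ 2 + ζ ^ 2 * z ^ 2) := by
    subst hs ht hu hv
    grind
  have ha (y z : K) : (s * y + t * z) ^ 4 = -ω / 4 * (y + ζ ^ 3 * z) ^ 4 := by
    have h : s * y + t * z = ω / 2 * (1 + ζ ^ 2) * (y + ζ ^ 3 * z) := by
      subst hs ht
      linear_combination ω / 2 * (-ζ * z) * hζ
    rw [h]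
    have e : (1 + ζ ^ 2) ^ 4 = -4 := by linear_combination (ζ ^ 4 + 4 * ζ ^ 2 + 5) * hζ
    have h' : (ω / 2 * (1 + ζ ^ 2)) ^ 4 = -ω / 4 := by
      linear_combination ω ^ 4 / 16 * e - ω / 4 * hω3
    rw [mul_pow, h']
  have hc (y z : K) : (u * y + v * z) ^ 4 = ω / 4 * (y - ζ ^ 3 * z) ^ 4 := by
    have h : u * y + v * z = ω / 2 * (1 - ζ ^ 2) * ζ * (y - ζ ^ 3 * z) := by
      subst hu hv
      linear_combination ω / 2 * (1 - ζ ^ 2) * z * hζ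
    rw [h]
    have e : (1 - ζ ^ 2) ^ 4 = -4 := by linear_combination (ζ ^ 4 - 4 * ζ ^ 2 + 5) * hζ
    have h' : (ω / 2 * (1 - ζ ^ 2) * ζ) ^ 4 = ω / 4 := by
      linear_combination ω ^ 4 / 16 * ζ ^ 4 * e - ω ^ 4 / 4 * hζ + ω / 4 * hω3
    rw [mul_pow, h']
  refine ⟨pgl (blockMatrix s t u v), pgl_blockMatrix_mem_planeAut hdet0 ?_ ?_, ?_⟩
  · intro y z
    have h : (s * y + t * z) ^ 4 + (u * y + v * z) ^ 4
        = -2 * ω * ζ ^ 3 * y * z * (y ^ 2 - ζ ^ 2 * z ^ 2) := by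
      rw [ha, hc]
      linear_combination -2 * ω * y * z ^ 3 * ζ ^ 5 * hζ
    calc _ = (s * y + t * z) * (u * y + v * z) * ((s * y + t * z) ^ 4 + (u * y + v * z) ^ 4) := by
          ring
      _ = _ := by
        rw [hmul, h]
        linear_combination -ζ ^ 4 * y * z * (y ^ 4 - ζ ^ 4 * z ^ 4) * hω3
          + y * z * (-y ^ 4 + (ζ ^ 4 - 1) * z ^ 4) * hζ
  · intro y z
    have h : (u * y + v * z) ^ 4 - (s * y + t * z) ^ 4
        = ω / 2 * (y ^ 4 - 6 * ζ ^ 2 * y ^ 2 * z ^ 2 - z ^ 4) := by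
      rw [ha, hc]
      linear_combination ω / 2 * (6 * ζ ^ 2 * y ^ 2 * z ^ 2 + z ^ 4 * (ζ ^ 8 - ζ ^ 4 + 1)) * hζ
    rw [mul_assoc γ, ← mul_pow, hmul, h, hγ]
    linear_combination β * (-(1 / 2) * ζ ^ 4 * (2 * ω + 1) * ω
      * (y ^ 4 + 2 * ζ ^ 2 * y ^ 2 * z ^ 2 + ζ ^ 4 * z ^ 4) * hω3
      - (1 / 2) * (2 * ω ^ 2 + ω)
        * (y ^ 4 + 2 * ζ ^ 2 * y ^ 2 * z ^ 2 + (ζ ^ 4 - 1) * z ^ 4) * hζ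
      + (y ^ 4 - z ^ 4 + 2 * ζ ^ 2 * y ^ 2 * z ^ 2) * hω)
  · have h2 : pgl (blockMatrix s t u v) ^ 2
        = pgl (blockMatrix (ω * s - ω ^ 2) (ω * t) (ω * u) (ω * v - ω ^ 2)) := by
      rw [pow_two, pgl_blockMatrix_mul hdet0 hdet0]
      congr 2
      · linear_combination s * htr - hdet
      · linear_combination t * htr
      · linear_combination u * htr
      · linear_combination v * htr - hdet
    have hdet2 : (ω * s - ω ^ 2) * (ω * v - ω ^ 2) - (ω * t) * (ω * u) ≠ 0 := by
      rw [show (ω * s - ω ^ 2) * (ω * v - ω ^ 2) - (ω * t) * (ω * u) = ω ^ 4 by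
        linear_combination ω ^ 2 * hdet - ω ^ 3 * htr]
      exact pow_ne_zero 4 hω0
    have h3 : pgl (blockMatrix s t u v) ^ 3 = pgl (blockMatrix (-1) 0 0 (-1)) := by
      rw [pow_succ, h2, pgl_blockMatrix_mul hdet2 hdet0]
      congr 2
      · linear_combination ω * (s * htr - hdet) - hω3
      · linear_combination ω * t * htr
      · linear_combination ω * u * htr
      · linear_combination ω * (v * htr - hdet) - hω3
    apply lt_orderOf_of_pow_six_eq_one
    · rw [h2]
      exact pgl_blockMatrix_ne_one hdet2 (.inr (mul_ne_zero hω0 hu0))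
    · rw [h3]
      exact pgl_blockMatrix_ne_one (by simp) (.inl (by norm_num))
    · rw [pow_mul _ 3 2, h3, pow_two, pgl_blockMatrix_mul (by simp) (by simp), ← pgl_one,
        ← blockMatrix_one]
      congr 2 <;> ring

theorem first_row_col_of_eval_mulVec [CharZero K] {β γ e : K} (A : GL3 K)
    (h12 : γ ^ 2 ≠ 12 * β ^ 2)
    (h : ∀ w, eval ((A : Matrix (Fin 3) (Fin 3) K).mulVec w) (quaternionSextic β γ)
      = e * eval w (quaternionSextic β γ)) :
    A.val 0 0 ≠ 0 ∧ A.val 1 0 = 0 ∧ A.val 2 0 = 0 ∧ A.val 0 1 = 0 ∧ A.val 0 2 = 0 := by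
  obtain ⟨B, hB⟩ : ∃ B : Matrix (Fin 3) (Fin 3) K, B = A⁻¹.val := ⟨_, rfl⟩
  have hAB : A.val * B = 1 := by rw [hB, ← Units.val_mul, mul_inv_cancel, Units.val_one]
  have hBA : B * A.val = 1 := by rw [hB, ← Units.val_mul, inv_mul_cancel, Units.val_one]
  have hT (Y₀ Y₁ Y₂ : K) := third_polar_eq (β := β) (γ := γ) (e := e)
    (x := A.val 0 0) (y := A.val 1 0) (z := A.val 2 0) (Y₀ := Y₀) (Y₁ := Y₁) (Y₂ := Y₂)
    (L := B 0 0 * Y₀ + B 0 1 * Y₁ + B 0 2 * Y₂) (M := B 1 0 * Y₀ + B 1 1 * Y₁ + B 1 2 * Y₂)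
    (N := B 2 0 * Y₀ + B 2 1 * Y₁ + B 2 2 * Y₂) fun t => by
      have ht := h (![1, 0, 0] + t • B.mulVec ![Y₀, Y₁, Y₂])
      rw [Matrix.mulVec_add, Matrix.mulVec_smul, Matrix.mulVec_mulVec, hAB, Matrix.one_mulVec,
        eval_quaternionSextic, eval_quaternionSextic] at ht
      simpa [Matrix.mulVec, dotProduct, Fin.sum_univ_three] using ht
  have hv : A.val 0 0 ≠ 0 ∨ A.val 1 0 ≠ 0 ∨ A.val 2 0 ≠ 0 := by
    by_contra! h0
    have := congrFun (congrFun hBA 0) 0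
    simp [Matrix.mul_apply, Fin.sum_univ_three, h0] at this
  have h000 : 120 * A.val 0 0 ^ 3 = 120 * e * B 0 0 ^ 3 := by linear_combination hT 1 0 0
  have h111 := hT 0 1 0
  have h222 := hT 0 0 1
  have h001 : 2 * (-4 * β * A.val 1 0 ^ 3 + 2 * γ * A.val 1 0 * A.val 2 0 ^ 2)
      = 120 * e * B 0 0 ^ 2 * B 0 1 := by
    linear_combination (1 / 6) * (hT 1 1 0 - hT 1 (-1) 0 - 2 * h111)
  have h002 : 2 * (4 * β * A.val 2 0 ^ 3 + 2 * γ * A.val 1 0 ^ 2 * A.val 2 0)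
      = 120 * e * B 0 0 ^ 2 * B 0 2 := by
    linear_combination (1 / 6) * (hT 1 0 1 - hT 1 0 (-1) - 2 * h222)
  have h011 : 2 * A.val 0 0 * (-12 * β * A.val 1 0 ^ 2 + 2 * γ * A.val 2 0 ^ 2)
      = 120 * e * B 0 0 * B 0 1 ^ 2 := by
    linear_combination (1 / 6) * (hT 1 1 0 + hT 1 (-1) 0) - (1 / 3) * h000
  have h022 : 2 * A.val 0 0 * (12 * β * A.val 2 0 ^ 2 + 2 * γ * A.val 1 0 ^ 2)
      = 120 * e * B 0 0 * B 0 2 ^ 2 := by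
    linear_combination (1 / 6) * (hT 1 0 1 + hT 1 0 (-1)) - (1 / 3) * h000
  have h112 : A.val 0 0 ^ 2 * (4 * γ * A.val 2 0) + 20 * A.val 1 0 ^ 3
      = 120 * e * B 0 1 ^ 2 * B 0 2 := by
    linear_combination (1 / 6) * (hT 0 1 1 - hT 0 1 (-1) - 2 * h222)
  have h122 : A.val 0 0 ^ 2 * (4 * γ * A.val 1 0) + 20 * A.val 2 0 ^ 3
      = 120 * e * B 0 1 * B 0 2 ^ 2 := by
    linear_combination (1 / 6) * (hT 0 1 1 + hT 0 1 (-1) - 2 * h111)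
  have h012 : 2 * A.val 0 0 * (4 * γ * A.val 1 0 * A.val 2 0)
      = 120 * e * B 0 0 * B 0 1 * B 0 2 := by
    linear_combination (1 / 6) * (hT 1 1 1 - hT 1 1 0 - hT 1 0 1 - hT 0 1 1 + hT 1 0 0
      + hT 0 1 0 + hT 0 0 1)
  obtain ⟨hy, hz, hx⟩ := (rank_one_third_polar hv h000 h001 h002 h011 h012 h022
    (by linear_combination h111) h112 h122 (by linear_combination h222)).resolve_right h12
  have hκ : 120 * e * B 0 0 ^ 2 ≠ 0 := fun h0 => hx <| by
    have : A.val 0 0 ^ 3 = 0 := by linear_combination (1 / 120) * (h000 + B 0 0 * h0)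
    exact pow_eq_zero_iff three_ne_zero |>.1 this
  have hb : B 0 1 = 0 := by
    rw [hy, hz] at h001
    exact (mul_eq_zero.1 (h001.symm.trans (by ring))).resolve_left hκ
  have hc : B 0 2 = 0 := by
    rw [hy, hz] at h002
    exact (mul_eq_zero.1 (h002.symm.trans (by ring))).resolve_left hκ
  have ha : B 0 0 ≠ 0 := by
    rintro h0
    simp [h0] at hκ
  have h1 := congrFun (congrFun hBA 0) 1
  have h2 := congrFun (congrFun hBA 0) 2
  simp [Matrix.mul_apply, Fin.sum_univ_three, hb, hc, ha] at h1 h2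
  exact ⟨hx, hy, hz, h1, h2⟩

theorem exists_blockMatrix_of_mem_planeAut [CharZero K] {β γ : K} (h12 : γ ^ 2 ≠ 12 * β ^ 2)
    {g : PGL3 K} (hg : g ∈ planeAut (quaternionSextic β γ)) :
    ∃ s t u v : K, g = pgl (blockMatrix s t u v) ∧ s * v - t * u ≠ 0 ∧
      (∀ y z : K, (s * y + t * z) ^ 5 * (u * y + v * z) + (s * y + t * z) * (u * y + v * z) ^ 5
        = y ^ 5 * z + y * z ^ 5) ∧
      ∀ y z : K, β * ((u * y + v * z) ^ 4 - (s * y + t * z) ^ 4)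
        + γ * (s * y + t * z) ^ 2 * (u * y + v * z) ^ 2
          = β * (z ^ 4 - y ^ 4) + γ * y ^ 2 * z ^ 2 := by
  obtain ⟨A, rfl, e, -, hA⟩ := hg
  have h (w : Fin 3 → K) : eval (A.val.mulVec w) (quaternionSextic β γ)
      = e * eval w (quaternionSextic β γ) := by rw [← eval_matAct, hA, smul_eval]
  obtain ⟨hx, h10, h20, h01, h02⟩ := first_row_col_of_eval_mulVec A h12 h
  obtain ⟨x, hx'⟩ : ∃ x, x = A.val 0 0 := ⟨_, rfl⟩
  rw [← hx'] at hx
  obtain ⟨s, hs⟩ : ∃ s, A.val 1 1 = x * s := ⟨A.val 1 1 / x, (mul_div_cancel₀ _ hx).symm⟩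
  obtain ⟨t, ht⟩ : ∃ t, A.val 1 2 = x * t := ⟨A.val 1 2 / x, (mul_div_cancel₀ _ hx).symm⟩
  obtain ⟨u, hu⟩ : ∃ u, A.val 2 1 = x * u := ⟨A.val 2 1 / x, (mul_div_cancel₀ _ hx).symm⟩
  obtain ⟨v, hv⟩ : ∃ v, A.val 2 2 = x * v := ⟨A.val 2 2 / x, (mul_div_cancel₀ _ hx).symm⟩
  have hAx : A.val = x • blockMatrix s t u v := by
    ext i j
    fin_cases i <;> fin_cases j <;> simp [blockMatrix, *]
  have hu' : IsUnit (blockMatrix s t u v) := by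
    rw [show blockMatrix s t u v = x⁻¹ • A.val by rw [hAx, inv_smul_smul₀ hx]]
    exact A.isUnit.smul (Units.mk0 x⁻¹ (inv_ne_zero hx))
  have key (y z : K) : x ^ 6 - e = 0 ∧ x ^ 6 * (β * ((u * y + v * z) ^ 4 - (s * y + t * z) ^ 4)
        + γ * (s * y + t * z) ^ 2 * (u * y + v * z) ^ 2)
        - e * (β * (z ^ 4 - y ^ 4) + γ * y ^ 2 * z ^ 2) = 0 ∧
      x ^ 6 * ((s * y + t * z) ^ 5 * (u * y + v * z) + (s * y + t * z) * (u * y + v * z) ^ 5)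
        - e * (y ^ 5 * z + y * z ^ 5) = 0 := by
    obtain ⟨h0, -, h2, -, -, -, h6⟩ := binary_coeff_eq_zero (K := K)
      (c₁ := 0) (c₃ := 0) (c₄ := 0) (c₅ := 0) (c₆ := x ^ 6 - e)
      (c₂ := x ^ 6 * (β * ((u * y + v * z) ^ 4 - (s * y + t * z) ^ 4)
        + γ * (s * y + t * z) ^ 2 * (u * y + v * z) ^ 2)
        - e * (β * (z ^ 4 - y ^ 4) + γ * y ^ 2 * z ^ 2))
      (c₀ := x ^ 6 * ((s * y + t * z) ^ 5 * (u * y + v * z)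
        + (s * y + t * z) * (u * y + v * z) ^ 5) - e * (y ^ 5 * z + y * z ^ 5)) fun r => by
      have hr := h ![r, y, z]
      rw [hAx, eval_quaternionSextic, eval_quaternionSextic] at hr
      simp [blockMatrix, Matrix.mulVec, dotProduct, Fin.sum_univ_three] at hr
      linear_combination hr
    exact ⟨h6, h2, h0⟩
  refine ⟨s, t, u, v, ?_, ?_, fun y z => ?_, fun y z => ?_⟩
  · rw [← pgl_coe, hAx, pgl_smul hu' hx]
  · rw [Matrix.isUnit_iff_isUnit_det, isUnit_iff_ne_zero, blockMatrix, Matrix.det_fin_three] at hu'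
    simpa using hu'
  · obtain ⟨h1, -, h2⟩ := key y z
    apply mul_left_cancel₀ (pow_ne_zero 6 hx)
    linear_combination h2 - (y ^ 5 * z + y * z ^ 5) * h1
  · obtain ⟨h1, h2, -⟩ := key y z
    apply mul_left_cancel₀ (pow_ne_zero 6 hx)
    linear_combination h2 - (β * (z ^ 4 - y ^ 4) + γ * y ^ 2 * z ^ 2) * h1

theorem pgl_blockMatrix_diag_pow {i : K} (hi : i ≠ 0) (k : ℕ) :
    pgl (blockMatrix i 0 0 i⁻¹) ^ k = pgl (blockMatrix (i ^ k) 0 0 (i ^ k)⁻¹) := by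
  induction k with
  | zero => simp [blockMatrix_one, pgl_one]
  | succ k ih =>
    rw [pow_succ, ih, pgl_blockMatrix_mul (by simp [hi]) (by simp [hi])]
    congr 2 <;> simp [pow_succ, mul_comm]

theorem exists_pow_eq_of_pow_four_eq_one {i s : K} (hi : i ^ 2 = -1) (hs : s ^ 4 = 1) :
    ∃ k : ℕ, s = i ^ k := by
  have h : (s - 1) * (s - i) * (s + 1) * (s + i) = 0 := by
    linear_combination hs - (s ^ 2 - 1) * hi
  rcases mul_eq_zero.1 h with h | h
  · rcases mul_eq_zero.1 h with h | h
    · rcases mul_eq_zero.1 h with h | h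
      · exact ⟨0, by linear_combination h⟩
      · exact ⟨1, by linear_combination h⟩
    · exact ⟨2, by linear_combination h - hi⟩
  · exact ⟨3, by linear_combination h - i * hi⟩

theorem quaternionSextic_parameters [IsAlgClosed K] [CharZero K] {ζ β γ : K} (hζ : ζ ^ 4 = -1)
    (hord : ∀ g ∈ planeAut (quaternionSextic β γ), orderOf g ≤ 4) :
    β ≠ 0 ∧ γ ^ 2 ≠ -4 * β ^ 2 ∧ γ ^ 2 ≠ 12 * β ^ 2 := by
  have hno : ¬∃ g ∈ planeAut (quaternionSextic β γ), 4 < orderOf g := fun ⟨g, hg, h⟩ =>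
    h.not_ge (hord g hg)
  have hβ : β ≠ 0 := by
    rintro rfl
    exact hno (exists_lt_orderOf_of_eq_zero hζ γ)
  refine ⟨hβ, fun h => hno ?_, fun h => hno ?_⟩
  · obtain ⟨e, he⟩ := IsAlgClosed.exists_pow_nat_eq (-1 / 2 : K) two_pos
    have he' : 2 * e ^ 2 = -1 := by rw [he]; ring
    have hf : (γ * ζ ^ 2 - 2 * β) * (γ * ζ ^ 2 + 2 * β) = 0 := by
      linear_combination γ ^ 2 * hζ - h
    rcases mul_eq_zero.1 hf with hf | hf
    · exact exists_lt_orderOf_of_mul_sq_eq hζ he' (by linear_combination hf)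
    · refine exists_lt_orderOf_of_mul_sq_eq (ε := ζ ^ 3) ?_ he' ?_
      · linear_combination (ζ ^ 8 - ζ ^ 4 + 1) * hζ
      · linear_combination γ * ζ ^ 2 * hζ - hf
  · refine exists_lt_orderOf_of_cube_root (ω := (γ * ζ ^ 2 / (2 * β) - 1) / 2) hζ ?_ ?_
    · field_simp
      linear_combination γ ^ 2 * hζ - h
    · field_simp
      linear_combination γ * hζ
/-- For `β₂₀, β₂₂` with `X⁶ + Y⁵Z + YZ⁵ + β₂₀X²(Z⁴ − Y⁴) + β₂₂X²Y²Z²` smooth and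
all automorphisms of order at most `4`, the automorphism group is generated by
`σ = diag(1, ζ₄, ζ₄⁻¹)` and `σ′ = [X : ζ₈Z : −ζ₈⁻¹Y]` (with `ζ₄ = ζ₈²`), and is isomorphic to
the quaternion group `Q₈` of order `8`. -/
theorem quaternion_sextic_automorphisms {K : Type*} [Field K] [IsAlgClosed K] [CharZero K]
    (ζ : K) (hζ : IsPrimitiveRoot ζ 8) (β20 β22 : K)
    (hsm : IsSmoothSextic (X 0 ^ 6 + X 1 ^ 5 * X 2 + X 1 * X 2 ^ 5
      + C β20 * X 0 ^ 2 * (X 2 ^ 4 - X 1 ^ 4)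
      + C β22 * X 0 ^ 2 * X 1 ^ 2 * X 2 ^ 2 : MvPolynomial (Fin 3) K))
    (hord : ∀ g ∈ planeAut (X 0 ^ 6 + X 1 ^ 5 * X 2 + X 1 * X 2 ^ 5
      + C β20 * X 0 ^ 2 * (X 2 ^ 4 - X 1 ^ 4)
      + C β22 * X 0 ^ 2 * X 1 ^ 2 * X 2 ^ 2 : MvPolynomial (Fin 3) K), orderOf g ≤ 4) :
    planeAut (X 0 ^ 6 + X 1 ^ 5 * X 2 + X 1 * X 2 ^ 5
        + C β20 * X 0 ^ 2 * (X 2 ^ 4 - X 1 ^ 4)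
        + C β22 * X 0 ^ 2 * X 1 ^ 2 * X 2 ^ 2 : MvPolynomial (Fin 3) K)
      = Subgroup.closure
        {pgl !![1, 0, 0; 0, ζ ^ 2, 0; 0, 0, (ζ ^ 2)⁻¹],
          pgl !![1, 0, 0; 0, 0, ζ; 0, -ζ⁻¹, 0]} ∧
    Nonempty (↥(planeAut (X 0 ^ 6 + X 1 ^ 5 * X 2 + X 1 * X 2 ^ 5
        + C β20 * X 0 ^ 2 * (X 2 ^ 4 - X 1 ^ 4)
        + C β22 * X 0 ^ 2 * X 1 ^ 2 * X 2 ^ 2 : MvPolynomial (Fin 3) K))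
      ≃* QuaternionGroup 2) := by
  have hζ4 : ζ ^ 4 = -1 := by
    have h1 : ζ ^ 4 ≠ 1 := hζ.pow_ne_one_of_pos_of_lt (by norm_num) (by norm_num)
    have h2 : (ζ ^ 4 - 1) * (ζ ^ 4 + 1) = 0 := by linear_combination hζ.pow_eq_one
    linear_combination (mul_eq_zero.1 h2).resolve_left (sub_ne_zero.2 h1)
  have hζ0 : ζ ≠ 0 := hζ.ne_zero (by norm_num)
  have hi0 : ζ ^ 2 ≠ 0 := pow_ne_zero 2 hζ0
  have hi : (ζ ^ 2) ^ 2 = -1 := by linear_combination hζ4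
  have hinv : ζ⁻¹ = -ζ ^ 3 := inv_eq_of_mul_eq_one_right (by linear_combination -hζ4)
  have hi_inv : (ζ ^ 2)⁻¹ = -ζ ^ 2 := inv_eq_of_mul_eq_one_right (by linear_combination -hζ4)
  obtain ⟨hβ, hγ4, hγ12⟩ := quaternionSextic_parameters hζ4 hord
  have hdS : ζ ^ 2 * (ζ ^ 2)⁻¹ - 0 * 0 ≠ 0 := by simp [hζ0]
  have hdT : (0 : K) * 0 - ζ * -ζ⁻¹ ≠ 0 := by simp [hζ0]
  have hpow (k : ℕ) := pgl_blockMatrix_diag_pow hi0 k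
  refine quaternionGroup_of_relations (s := pgl (blockMatrix (ζ ^ 2) 0 0 (ζ ^ 2)⁻¹))
    (t := pgl (blockMatrix 0 ζ (-ζ⁻¹) 0)) _ ?_ ?_ ?_ ?_ ?_ ?_ fun g hg => ?_
  · refine pgl_blockMatrix_mem_planeAut hdS (fun y z => ?_) fun y z => ?_ <;> rw [hi_inv]
    · linear_combination (-ζ ^ 8 * y ^ 5 * z - ζ ^ 8 * y * z ^ 5 + ζ ^ 4 * y ^ 5 * z
        + ζ ^ 4 * y * z ^ 5 - y ^ 5 * z - y * z ^ 5) * hζ4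
    · linear_combination (β20 * (z ^ 4 - y ^ 4) + β22 * y ^ 2 * z ^ 2) * (ζ ^ 4 - 1) * hζ4
  · refine pgl_blockMatrix_mem_planeAut hdT (fun y z => ?_) fun y z => ?_ <;> rw [hinv]
    · linear_combination (y * z ^ 5 + y ^ 5 * z * (ζ ^ 8 + 1)) * (ζ ^ 4 - 1) * hζ4
    · linear_combination (β20 * y ^ 4 * (ζ ^ 8 - ζ ^ 4 + 1) - β20 * z ^ 4
        + β22 * y ^ 2 * z ^ 2 * (ζ ^ 4 - 1)) * hζ4
  · rw [hpow, show (ζ ^ 2) ^ 4 = 1 by linear_combination (ζ ^ 4 - 1) * hζ4, inv_one,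
      blockMatrix_one, pgl_one]
  · rw [hpow, hi]
    exact pgl_blockMatrix_ne_one (by simp) (.inl (by norm_num))
  · rw [hpow, hi, pow_two, pgl_blockMatrix_mul hdT hdT]
    congr 2 <;> simp [hζ0, inv_neg]
  · have hS : (pgl (blockMatrix (ζ ^ 2) 0 0 (ζ ^ 2)⁻¹))⁻¹
        = pgl (blockMatrix (ζ ^ 2)⁻¹ 0 0 (ζ ^ 2)) := by
      rw [inv_eq_iff_mul_eq_one, pgl_blockMatrix_mul hdS (by simp [hζ0]), ← pgl_one,
        ← blockMatrix_one]
      congr 2 <;> simp [hζ0]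
    rw [hS, pgl_blockMatrix_mul hdT hdS, pgl_blockMatrix_mul (by simp [hζ0]) hdT]
    congr 2 <;> simp [mul_comm]
  · obtain ⟨s, t, u, v, rfl, hdet, hp, hq⟩ := exists_blockMatrix_of_mem_planeAut hγ12 hg
    rcases blockForm_of_form_invariant hdet hp hq hβ hγ4 hγ12 with
      ⟨rfl, rfl, hs, hsv⟩ | ⟨rfl, rfl, hu, htu⟩
    · obtain ⟨k, rfl⟩ := exists_pow_eq_of_pow_four_eq_one hi hs
      exact ⟨k, .inl (by rw [hpow, eq_inv_of_mul_eq_one_right hsv])⟩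
    · obtain ⟨k, hk⟩ := exists_pow_eq_of_pow_four_eq_one (s := -ζ * u) hi
        (by linear_combination u ^ 4 * hζ4 - hu)
      refine ⟨k, .inr ?_⟩
      have hu0 : u ≠ 0 := by rintro rfl; simp at htu
      rw [hpow, pgl_blockMatrix_mul hdT (by simp [hζ0]), ← hk]
      congr 2
      · simp
      · field_simp
        linear_combination htu
      · field_simp
        simp
      · simp
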